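/- Let k be a field, Λ a finite free k-module of rank 2g with a perfect alternating bilinear form, and let S be a k-scheme. Then the assignment sending a Lagrangian submodule L ⊆ Λ ⊗_k O_S (a totally isotropic O_S-submodule which is Zariski-locally a direct summand of rank g) to its stabilizer in GSp(Λ)_S gives an injection from the set of Lagrangians in Λ ⊗_k O_S to the set of subgroup schemes of GSp(Λ)_S; in particular two Lagrangians with the same stabilizer are equal. -/

import Mathlib

open TensorProduct

/-- A Lagrangian submodule: totally isotropic, (locally) a direct summand, finite projective
of rank `g` at every prime. -/
def IsLagrangian {A : Type} [CommRing A] {M : Type} [AddCommGroup M] [Module A M]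
    (ω : LinearMap.BilinForm A M) (g : ℕ) (L : Submodule A M) : Prop :=
  (∀ x ∈ L, ∀ y ∈ L, ω x y = 0) ∧
  (∃ L' : Submodule A M, IsCompl L L') ∧
  Module.Finite A L ∧ Module.Projective A L ∧
  ∀ (𝔭 : Ideal A) [𝔭.IsPrime],
    Module.finrank (Localization.AtPrime 𝔭) (LocalizedModule 𝔭.primeCompl L) = g

/-- A finite projective module and its dual have the same rank at every prime. -/
lemma rankAtStalk_dual {R M : Type*} [CommRing R] [AddCommGroup M] [Module R M]
    [Module.Finite R M] [Module.Projective R M] :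
    Module.rankAtStalk (R := R) (Module.Dual R M) = Module.rankAtStalk (R := R) M := by
  ext p
  have := Module.finitePresentation_of_projective R M
  have e := (Module.FinitePresentation.linearEquivMapExtendScalars (M := M) (N := R)
    p.asIdeal.primeCompl).extendScalarsOfIsLocalization p.asIdeal.primeCompl
      (Localization.AtPrime p.asIdeal)
  have : Nontrivial R := p.nontrivial
  have : Module.Free (Localization.AtPrime p.asIdeal) (LocalizedModule p.asIdeal.primeCompl M) :=
    Module.free_of_flat_of_isLocalRing
  have : Module.Free (Localization.AtPrime p.asIdeal) (LocalizedModule p.asIdeal.primeCompl R) :=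
    Module.free_of_flat_of_isLocalRing
  have h1 := congrFun (Module.rankAtStalk_self (R := R)) p
  unfold Module.rankAtStalk at h1 ⊢
  refine e.finrank_eq.trans ?_
  rw [Module.finrank_linearMap, h1]
  simp

/-- An isotropic direct summand of half rank contains its orthogonal. -/
lemma mem_of_orthogonal_of_rankAtStalk {A M : Type*} [CommRing A] [AddCommGroup M] [Module A M]
    [Module.Finite A M] [Module.Projective A M] {g : ℕ}
    (hM : ∀ p, Module.rankAtStalk (R := A) M p = 2 * g)
    {ω : LinearMap.BilinForm A M} (hω : Function.Surjective ω) {L N : Submodule A M}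
    (hiso : ∀ x ∈ L, ∀ y ∈ L, ω x y = 0) (hLN : IsCompl L N)
    (hL : ∀ p, Module.rankAtStalk (R := A) L p = g)
    {x : M} (hx : ∀ y ∈ L, ω x y = 0) : x ∈ L := by
  have key : ∀ {P Q : Submodule A M}, IsCompl P Q →
      Module.Finite A P ∧ Module.Projective A P := fun {P Q} h =>
    ⟨Module.Finite.of_surjective (P.projectionOnto Q h)
        (Submodule.projectionOnto_surjective h),
      Module.Projective.of_split P.subtype (P.projectionOnto Q h)
        (Submodule.projectionOnto_comp_subtype h)⟩
  obtain ⟨_, _⟩ := key hLN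
  obtain ⟨_, _⟩ := key hLN.symm
  let φ : N →ₗ[A] Module.Dual A L := L.subtype.dualMap ∘ₗ ω ∘ₗ N.subtype
  have hφ : Function.Surjective φ := by
    intro f
    obtain ⟨m, hm⟩ := hω (f ∘ₗ L.projectionOnto N hLN)
    obtain ⟨l, n, hl, hn, rfl⟩ := Submodule.codisjoint_iff_exists_add_eq.mp hLN.codisjoint m
    refine ⟨⟨n, hn⟩, ?_⟩
    ext y
    have := LinearMap.congr_fun hm y
    simpa [φ, hiso l hl y y.2] using this
  have hr : ∀ p, Module.rankAtStalk (R := A) N p =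
      Module.rankAtStalk (R := A) (Module.Dual A L) p := by
    intro p
    have h := congrFun (Module.rankAtStalk_eq_of_equiv (Submodule.prodEquivOfIsCompl L N hLN)) p
    rw [Module.rankAtStalk_prod, Pi.add_apply, hM, hL] at h
    rw [rankAtStalk_dual, hL]
    omega
  have hb := Module.bijective_of_surjective_of_rankAtStalk_eq hφ fun m _ => hr _
  obtain ⟨l, n, hl, hn, rfl⟩ := Submodule.codisjoint_iff_exists_add_eq.mp hLN.codisjoint x
  have h0 : φ ⟨n, hn⟩ = 0 := by
    ext y
    simpa [φ, hiso l hl y y.2] using hx y y.2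
  have h1 : (⟨n, hn⟩ : N) = 0 := hb.1 (h0.trans (map_zero φ).symm)
  have h2 : n = 0 := congrArg Subtype.val h1
  simpa [h2] using hl

/-- An alternating form on a finite free module is the antisymmetrization of a bilinear form. -/
lemma exists_bilinForm_sub_flip {A M : Type*} [CommRing A] [AddCommGroup M] [Module A M]
    [Module.Finite A M] [Module.Free A M] (ω : LinearMap.BilinForm A M)
    (halt : ∀ x, ω x x = 0) : ∃ β : LinearMap.BilinForm A M, ω = β - β.flip := by
  classical
  let b := (Module.Free.chooseBasis A M).reindex (Fintype.equivFin _)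
  let T : Matrix _ _ A := Matrix.of fun i j => if i < j then ω (b i) (b j) else 0
  have hT : ∀ i j, Matrix.toBilin b T (b i) (b j) = if i < j then ω (b i) (b j) else 0 :=
    fun i j => by
      rw [← LinearMap.BilinForm.toMatrix_apply, LinearMap.BilinForm.toMatrix_toBilin]
      rfl
  refine ⟨Matrix.toBilin b T, ?_⟩
  have hs : ∀ x y, ω x y = - ω y x := fun x y => by
    have := halt (x + y)
    simp only [map_add, LinearMap.add_apply, halt] at this
    linear_combination this
  refine LinearMap.BilinForm.ext_basis b fun i j => ?_
  simp only [LinearMap.sub_apply, LinearMap.BilinForm.flip_apply, hT]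
  rcases lt_trichotomy i j with h | rfl | h
  · simp [h, h.not_gt]
  · simp [halt]
  · simp [h, h.not_gt, hs (b i) (b j)]

/-- If every infinitesimal similitude preserving the Lagrangian `L₁` preserves the isotropic
direct summand `L₂`, then `L₂ ≤ L₁`. -/
lemma le_of_infinitesimal_stabilizer_le {A M : Type*} [CommRing A] [AddCommGroup M] [Module A M]
    [Module.Finite A M] [Module.Free A M] {ω β : LinearMap.BilinForm A M}
    (hβ : ω = β - β.flip) (hω : Function.Surjective ω) {L₁ N₁ L₂ N₂ : Submodule A M}
    (hiso₁ : ∀ x ∈ L₁, ∀ y ∈ L₁, ω x y = 0) (hc₁ : IsCompl L₁ N₁)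
    (hmax : ∀ x, (∀ y ∈ L₁, ω x y = 0) → x ∈ L₁)
    (hiso₂ : ∀ x ∈ L₂, ∀ y ∈ L₂, ω x y = 0) (hc₂ : IsCompl L₂ N₂)
    (hstab : ∀ (P : M →ₗ[A] M) (c : A), (∀ x y, ω (P x) y + ω x (P y) = c * ω x y) →
      (∀ v ∈ L₁, P v ∈ L₁) → ∀ v ∈ L₂, P v ∈ L₂) : L₂ ≤ L₁ := by
  have hsub : ∀ x y, ω x y = β x y - β y x := fun x y => by rw [hβ]; rfl
  have hneg : ∀ x y, ω x y = - ω y x := fun x y => by rw [hsub, hsub]; ring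
  -- The projection onto `N₁` along `L₁` is corrected to one with isotropic range.
  let e : M →ₗ[A] M := N₁.projection L₁ hc₁.symm
  have he0 : ∀ l ∈ L₁, e l = 0 := fun l hl => by
    simpa [e, Submodule.projection_apply_eq_zero_iff] using hl
  have he : ∀ x, x - e x ∈ L₁ := Submodule.sub_projection_mem hc₁.symm
  obtain ⟨s, hs⟩ := Module.projective_lifting_property ω LinearMap.id hω
  let E : M →ₗ[A] M := s ∘ₗ (β.compl₁₂ e e)
  have hE : ∀ x y, ω (E x) y = β (e x) (e y) := fun x y =>
    LinearMap.congr_fun (LinearMap.congr_fun hs (β.compl₁₂ e e x)) y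
  have hEL : ∀ x, E x ∈ L₁ := fun x => hmax _ fun y hy => by simp [hE, he0 y hy]
  have hE0 : ∀ l ∈ L₁, E l = 0 := fun l hl => by
    have : β.compl₁₂ e e l = 0 := by ext y; simp [he0 l hl]
    simp [E, this]
  let e' : M →ₗ[A] M := e - E
  have he'0 : ∀ l ∈ L₁, e' l = 0 := fun l hl => by simp [e', he0 l hl, hE0 l hl]
  have he' : ∀ x, x - e' x ∈ L₁ := fun x => by
    have : x - e' x = (x - e x) + E x := by simp only [e', LinearMap.sub_apply]; abel
    rw [this]
    exact L₁.add_mem (he x) (hEL x)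
  have he'e' : ∀ x, e' (e' x) = e' x := fun x => by
    have := he'0 _ (he' x)
    rw [map_sub, sub_eq_zero] at this
    exact this.symm
  have hiso' : ∀ x y, ω (e' x) (e' y) = 0 := fun x y => by
    have h1 := hiso₁ _ (hEL x) _ (he y)
    have h2 := hiso₁ _ (hEL y) _ (he x)
    have h3 := hiso₁ _ (hEL x) _ (hEL y)
    simp only [map_sub, hE] at h1 h2
    have h4 := hE x (e y)
    have h5 := hE y (e x)
    have h6 := hsub (e x) (e y)
    have h7 := hneg (e x) (E y)
    simp only [e', LinearMap.sub_apply, map_sub]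
    linear_combination h1 - h2 + h3 + h6 - h7 - h4 + h5
  have hp : ∀ v ∈ L₂, e' v ∈ L₂ := fun v hv => by
    have := hstab (LinearMap.id - e') 1 (fun x y => by
      have h1 := hiso₁ _ (he' x) _ (he' y)
      have h2 := hiso' x y
      simp only [map_sub, LinearMap.sub_apply, LinearMap.id_apply] at h1 ⊢
      linear_combination h1 - h2) (fun x _ => he' x) v hv
    simpa using L₂.sub_mem hv this
  have hsq : ∀ v ∈ L₁, ∀ x ∈ L₂, ω v x * ω v x = 0 := fun v hv x hx => by
    have := hstab ((ω v).smulRight v) 0 (fun x y => by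
      simp only [LinearMap.smulRight_apply, map_smul, LinearMap.smul_apply, smul_eq_mul]
      rw [hneg x v]
      ring) (fun l hl => by simp [hiso₁ v hv l hl]) x hx
    simpa using hiso₂ _ this _ hx
  let r : M →ₗ[A] M := L₂.projection N₂ hc₂
  have hr : ∀ x ∈ L₂, r x = x := fun x hx => Submodule.projection_apply_of_mem_left hc₂ hx
  have hrL : ∀ x, r x ∈ L₂ := Submodule.projection_apply_mem hc₂
  let Q : Submodule A M := LinearMap.range (e' ∘ₗ r)
  have hnil : ∀ x ∈ Q, ∀ f : Module.Dual A M, f x ∈ nilradical A := by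
    rintro _ ⟨m, rfl⟩ f
    obtain ⟨z, rfl⟩ := hω f
    have h1 := hsq _ (he' z) _ (hp _ (hrL m))
    have h2 := hiso' z (r m)
    simp only [map_sub, LinearMap.sub_apply, h2, sub_zero] at h1
    exact ⟨2, by rw [pow_two]; exact h1⟩
  have hQ : Q = ⊥ := by
    refine Submodule.eq_bot_of_le_smul_of_le_jacobson_bot (nilradical A) Q
      (Module.Finite.iff_fg.mp inferInstance) (fun x hx => ?_) ?_
    · let b := Module.Free.chooseBasis A M
      have hx' : (e' ∘ₗ r) x = x := by
        obtain ⟨m, rfl⟩ := hx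
        simp [hr _ (hp _ (hrL m)), he'e']
      rw [← hx', ← b.sum_repr x, map_sum]
      refine Submodule.sum_mem _ fun i _ => ?_
      rw [map_smul]
      exact Submodule.smul_mem_smul (hnil x hx (b.coord i)) ⟨_, rfl⟩
    · exact Ideal.radical_le_jacobson
  intro x hx
  have h1 : e' x ∈ Q := ⟨x, by simp [hr x hx]⟩
  rw [hQ, Submodule.mem_bot] at h1
  simpa [h1] using he' x

section DualNumber

open DualNumber

variable {A M : Type*} [CommRing A] [AddCommGroup M] [Module A M]

/-- The automorphism `1 + εP` of `A[ε] ⊗ M` attached to an endomorphism `P` of `M`. -/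
noncomputable def infinitesimalEquiv (P : M →ₗ[A] M) : (A[ε] ⊗[A] M) ≃ₗ[A[ε]] (A[ε] ⊗[A] M) :=
  LinearEquiv.ofLinearMap
    (LinearMap.id + (ε : A[ε]) • P.baseChange A[ε])
    (LinearMap.id - (ε : A[ε]) • P.baseChange A[ε])
    (by ext x; simp [TensorProduct.smul_tmul', smul_sub])
    (by ext x; simp [TensorProduct.smul_tmul', smul_add])

lemma infinitesimalEquiv_one_tmul (P : M →ₗ[A] M) (x : M) :
    infinitesimalEquiv P (1 ⊗ₜ x) = 1 ⊗ₜ x + ε ⊗ₜ P x := by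
  simp [infinitesimalEquiv, TensorProduct.smul_tmul']

lemma baseChange_infinitesimalEquiv {ω : LinearMap.BilinForm A M} {P : M →ₗ[A] M} {c : A}
    (hP : ∀ x y, ω (P x) y + ω x (P y) = c * ω x y) (x y : A[ε] ⊗[A] M) :
    ω.baseChange A[ε] (infinitesimalEquiv P x) (infinitesimalEquiv P y) =
      (1 + c • ε) * ω.baseChange A[ε] x y := by
  have : (ω.baseChange A[ε]).compl₁₂ (infinitesimalEquiv P).toLinearMap
      (infinitesimalEquiv P).toLinearMap = (1 + c • ε : A[ε]) • ω.baseChange A[ε] := by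
    ext x y
    · simp [infinitesimalEquiv_one_tmul]
    · have := hP x y
      simp [infinitesimalEquiv_one_tmul]
      linear_combination this
  exact LinearMap.congr_fun₂ this x y

lemma infinitesimalEquiv_stabilizes_iff (P : M →ₗ[A] M) (L : Submodule A M) :
    (∀ v ∈ L.baseChange A[ε], infinitesimalEquiv P v ∈ L.baseChange A[ε]) ↔
      ∀ v ∈ L, P v ∈ L := by
  constructor
  · intro h v hv
    have h1 := h _ (Submodule.tmul_mem_baseChange_of_mem 1 hv)
    rw [infinitesimalEquiv_one_tmul] at h1
    have h2 := (Submodule.add_mem_iff_right _ (Submodule.tmul_mem_baseChange_of_mem 1 hv)).1 h1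
    let σ : A[ε] ⊗[A] M →ₗ[A] M :=
      TensorProduct.lid A M ∘ₗ (TrivSqZeroExt.sndHom A A).rTensor M
    have hσ : ∀ w ∈ L.baseChange A[ε], σ w ∈ L := by
      rintro _ ⟨w, rfl⟩
      induction w with
      | zero => simp
      | tmul b l => simpa [σ] using L.smul_mem _ l.2
      | add a b ha hb => rw [map_add, map_add]; exact L.add_mem ha hb
    simpa [σ] using hσ _ h2
  · rintro h _ ⟨w, rfl⟩
    induction w with
    | zero => simp
    | tmul b l =>
      have : (b ⊗ₜ (l : M) : A[ε] ⊗[A] M) = b • (1 ⊗ₜ (l : M)) := by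
        simp [TensorProduct.smul_tmul']
      simp only [LinearMap.baseChange_tmul, Submodule.subtype_apply]
      rw [this, map_smul, infinitesimalEquiv_one_tmul]
      exact Submodule.smul_mem _ _ (Submodule.add_mem _
        (Submodule.tmul_mem_baseChange_of_mem _ l.2)
        (Submodule.tmul_mem_baseChange_of_mem _ (h _ l.2)))
    | add a b ha hb => rw [map_add, map_add]; exact Submodule.add_mem _ ha hb

lemma isUnit_one_add_smul_eps (c : A) : IsUnit (1 + c • ε : A[ε]) :=
  IsUnit.of_mul_eq_one (1 - c • ε) (by ext <;> simp)

end DualNumber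

/-- Surjectivity of a bilinear form onto the dual is preserved by base change. -/
lemma baseChange_bilinForm_surjective {k A Λ : Type*} [CommRing k] [CommRing A] [Algebra k A]
    [AddCommGroup Λ] [Module k Λ] [Module.Free k Λ] [Module.Finite k Λ]
    {ω : LinearMap.BilinForm k Λ} (hω : Function.Surjective ω) :
    Function.Surjective (ω.baseChange A) := by
  classical
  intro f
  let b := Module.Free.chooseBasis k Λ
  choose d hd using fun i => hω (b.coord i)
  refine ⟨∑ i, f (1 ⊗ₜ b i) • (1 ⊗ₜ d i), (b.baseChange A).ext fun j => ?_⟩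
  simp [hd, Finsupp.single_apply]

/-- over an (affine) `k`-scheme `Spec A`, a Lagrangian `L ⊆ Λ ⊗_k A` is
determined by its stabilizer subgroup functor in `GSp(Λ)`: if two Lagrangians have the same
stabilizer (i.e. for every `A`-algebra `B`, a symplectic similitude of `B ⊗ Λ` stabilizes the
one iff it stabilizes the other), then they are equal; so `L ↦ Stab(L)` is injective. -/
theorem lagrangian_determined_by_stabilizer
    (k : Type) [Field k] (g : ℕ) (Λ : Type) [AddCommGroup Λ] [Module k Λ]
    [Module.Free k Λ] [Module.Finite k Λ] (hrank : Module.finrank k Λ = 2 * g)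
    (ω : LinearMap.BilinForm k Λ)
    (halt : ∀ x : Λ, ω x x = 0)
    (hperf : Function.Bijective ω)
    (A : Type) [CommRing A] [Algebra k A]
    (L₁ L₂ : Submodule A (A ⊗[k] Λ))
    (h₁ : IsLagrangian (LinearMap.BilinForm.baseChange A ω) g L₁)
    (h₂ : IsLagrangian (LinearMap.BilinForm.baseChange A ω) g L₂)
    (hstab : ∀ (B : Type) [CommRing B] [Algebra A B],
      ∀ φ : (B ⊗[A] (A ⊗[k] Λ)) ≃ₗ[B] (B ⊗[A] (A ⊗[k] Λ)),
      (∃ c : Bˣ, ∀ x y : B ⊗[A] (A ⊗[k] Λ),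
        (LinearMap.BilinForm.baseChange B (LinearMap.BilinForm.baseChange A ω)) (φ x) (φ y)
          = (c : B) * (LinearMap.BilinForm.baseChange B (LinearMap.BilinForm.baseChange A ω)) x y) →
      ((∀ v ∈ L₁.baseChange B, φ v ∈ L₁.baseChange B) ↔
       (∀ v ∈ L₂.baseChange B, φ v ∈ L₂.baseChange B))) :
    L₁ = L₂ := by
  have hβ : ∃ β, LinearMap.BilinForm.baseChange A ω = β - β.flip := by
    obtain ⟨β, hβ⟩ := exists_bilinForm_sub_flip ω halt
    refine ⟨β.baseChange A, ?_⟩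
    ext x y
    simp [hβ, sub_smul]
  obtain ⟨β, hβ⟩ := hβ
  have hsurj := baseChange_bilinForm_surjective (A := A) hperf.surjective
  have hM : ∀ p, Module.rankAtStalk (R := A) (A ⊗[k] Λ) p = 2 * g := fun p => by
    have : Nontrivial A := p.nontrivial
    rw [Module.rankAtStalk_eq_finrank_of_free]
    simp [hrank]
  have hlie : ∀ (P : A ⊗[k] Λ →ₗ[A] A ⊗[k] Λ) (c : A),
      (∀ x y, ω.baseChange A (P x) y + ω.baseChange A x (P y) = c * ω.baseChange A x y) →
      ((∀ v ∈ L₁, P v ∈ L₁) ↔ ∀ v ∈ L₂, P v ∈ L₂) := fun P c hP => by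
    have := hstab (DualNumber A) (infinitesimalEquiv P)
      ⟨(isUnit_one_add_smul_eps c).unit, baseChange_infinitesimalEquiv hP⟩
    rwa [infinitesimalEquiv_stabilizes_iff, infinitesimalEquiv_stabilizes_iff] at this
  obtain ⟨hi₁, ⟨N₁, hc₁⟩, -, -, hr₁⟩ := h₁
  obtain ⟨hi₂, ⟨N₂, hc₂⟩, -, -, hr₂⟩ := h₂
  refine le_antisymm
    (le_of_infinitesimal_stabilizer_le hβ hsurj hi₂ hc₂ (fun x hx => ?_) hi₁ hc₁
      fun P c hP => (hlie P c hP).2)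
    (le_of_infinitesimal_stabilizer_le hβ hsurj hi₁ hc₁ (fun x hx => ?_) hi₂ hc₂
      fun P c hP => (hlie P c hP).1)
  · exact mem_of_orthogonal_of_rankAtStalk hM hsurj hi₂ hc₂ (fun p => hr₂ p.asIdeal) hx
  · exact mem_of_orthogonal_of_rankAtStalk hM hsurj hi₁ hc₁ (fun p => hr₁ p.asIdeal) hx
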